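/- Fix r₀ ∈ (0,1) and let μ be the uniform probability measure on the parameter set 𝒬̃ = {(a,f,b,c,d,e,g) ∈ [0,1]² × ℂ⁵ : Q(a,f,b,c,d,e,g) is positive semidefinite} ⊂ ℝ¹². Then the pushforward of μ under the map (a,f,b,c,d,e,g) ↦ a + f − 1 + r₀(a − f) — the z-component of the image of the state with Bloch vector (0,0,r₀) — is the measure on ℝ with Lebesgue density f_z given, for ξ ∈ [−1,1], by: f_z(ξ) = (20(1−|ξ|)⁷/(33(1−r₀²)⁶))·(3ξ⁴ − 22ξ²r₀² + 99r₀⁴ + 21|ξ|³ − 154|ξ|r₀² + 51ξ² − 22r₀² + 21|ξ| + 3) if |ξ| > r₀, and f_z(ξ) = (−10/(33 r₀ (1+r₀)⁶))·(231ξ⁶ − 99ξ⁴r₀² + 33ξ²r₀⁴ − 5r₀⁶ − 594ξ⁴r₀ + 198ξ²r₀³ − 30r₀⁵ + 396ξ²r₀² − 72r₀⁴ + 66ξ²r₀ − 82r₀³ − 36r₀² − 6r₀) if |ξ| ≤ r₀ (and f_z(ξ) = 0 for |ξ| > 1). -/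

import Mathlib

open MeasureTheory Matrix Real ComplexOrder

/-- The Choi matrix of a general qubit channel with parameters `(a,f,b,c,d,e,g)`. -/
noncomputable def choiMat (a f : ℝ) (b c d e g : ℂ) : Matrix (Fin 4) (Fin 4) ℂ :=
  !![(a : ℂ), b, c, d;
     star b, 1 - (a : ℂ), e, -c;
     star c, star e, (f : ℂ), g;
     star d, -star c, star g, 1 - (f : ℂ)]

/-- The parameter set of general qubit channels, a Borel subset of `ℝ¹²`. -/
def qubitChannelSet : Set (ℝ × ℝ × ℂ × ℂ × ℂ × ℂ × ℂ) :=
  {p | p.1 ∈ Set.Icc (0 : ℝ) 1 ∧ p.2.1 ∈ Set.Icc (0 : ℝ) 1 ∧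
    (choiMat p.1 p.2.1 p.2.2.1 p.2.2.2.1 p.2.2.2.2.1 p.2.2.2.2.2.1
      p.2.2.2.2.2.2).PosSemidef}

/-- The uniform probability measure on the set of qubit channels. -/
noncomputable def uniformQubitChannel : Measure (ℝ × ℝ × ℂ × ℂ × ℂ × ℂ × ℂ) :=
  (volume qubitChannelSet)⁻¹ • volume.restrict qubitChannelSet

open scoped ENNReal

/-- Change of variables `x ↦ γ • x + w` in a lower Lebesgue integral. -/
lemma lintegral_eq_mul_lintegral_smul_add {E : Type*} [NormedAddCommGroup E] [NormedSpace ℝ E]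
    [MeasurableSpace E] [BorelSpace E] [FiniteDimensional ℝ E] (μ : Measure E)
    [μ.IsAddHaarMeasure] (F : E → ℝ≥0∞) {γ : ℝ} (hγ : 0 < γ) (w : E) :
    ∫⁻ x, F x ∂μ
      = ENNReal.ofReal (γ ^ Module.finrank ℝ E) * ∫⁻ x, F (γ • x + w) ∂μ := by
  have h1 : ∫⁻ x, F (γ • x + w) ∂μ = ∫⁻ x, F (x + w) ∂(Measure.map (γ • ·) μ) :=
    ((Homeomorph.smulOfNeZero γ hγ.ne').measurableEmbedding.lintegral_map
      (fun x => F (x + w))).symm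
  rw [h1, Measure.map_addHaar_smul μ hγ.ne', lintegral_smul_measure,
    lintegral_add_right_eq_self (μ := μ) F w, smul_eq_mul, ← mul_assoc,
    ← ENNReal.ofReal_mul (by positivity), abs_of_pos (by positivity),
    mul_inv_cancel₀ (by positivity), ENNReal.ofReal_one, one_mul]

lemma lintegral_complex_eq_mul (F : ℂ → ℝ≥0∞) {γ : ℝ} (hγ : 0 < γ) (w : ℂ) :
    ∫⁻ x, F x = ENNReal.ofReal (γ ^ 2) * ∫⁻ x, F (γ * x + w) := by
  simpa using lintegral_eq_mul_lintegral_smul_add volume F hγ w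

lemma lintegral_real_eq_mul (F : ℝ → ℝ≥0∞) {γ : ℝ} (hγ : 0 < γ) (w : ℝ) :
    ∫⁻ x, F x = ENNReal.ofReal γ * ∫⁻ x, F (γ * x + w) := by
  simpa using lintegral_eq_mul_lintegral_smul_add volume F hγ w

/-- The Choi matrix with unit diagonal and vanishing entry `c`. -/
noncomputable def unitChoiMat (b d e g : ℂ) : Matrix (Fin 4) (Fin 4) ℂ :=
  !![1, b, 0, d;
     star b, 1, e, 0;
     0, star e, 1, g;
     star d, 0, star g, 1]

/-- Block elimination of the entry `c` followed by normalization of the diagonal. -/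
lemma choiMat_posSemidef_iff {x₁ x₂ x₃ x₄ : ℝ} (h₁ : 0 < x₁) (h₂ : 0 < x₂) (h₃ : 0 < x₃)
    (h₄ : 0 < x₄) {a f : ℝ} {c : ℂ} (ha : x₁ ^ 2 = a) (ha' : x₂ ^ 2 = 1 - a)
    (hf : ‖c‖ ^ 2 / a + x₃ ^ 2 = f) (hf' : ‖c‖ ^ 2 / (1 - a) + x₄ ^ 2 = 1 - f) (b d e g : ℂ) :
    (choiMat a f ((x₁ * x₂ : ℝ) * b + 0) c ((x₁ * x₄ : ℝ) * d + (-(x₁ * c / x₂) * b))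
      ((x₂ * x₃ : ℝ) * e + (x₂ * c / x₁ * star b))
      ((x₃ * x₄ : ℝ) * g + (-(star c * c / (x₁ * x₂)) * b + star c * x₄ / x₁ * d
        - c * x₃ / x₂ * star e))).PosSemidef ↔ (unitChoiMat b d e g).PosSemidef := by
  set W : Matrix (Fin 4) (Fin 4) ℂ :=
    !![(x₁ : ℂ), 0, 0, 0; 0, x₂, 0, 0; star c / x₁, 0, x₃, 0; 0, -star c / x₂, 0, x₄] with hW
  have e₁ : (x₁ : ℂ) ≠ 0 := by exact_mod_cast h₁.ne'
  have e₂ : (x₂ : ℂ) ≠ 0 := by exact_mod_cast h₂.ne'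
  have e₃ : (x₃ : ℂ) ≠ 0 := by exact_mod_cast h₃.ne'
  have e₄ : (x₄ : ℂ) ≠ 0 := by exact_mod_cast h₄.ne'
  have hdet : W.det = x₁ * x₂ * x₃ * x₄ := by
    simp [hW, Matrix.det_succ_row_zero, Fin.sum_univ_succ, Fin.succAbove]
    ring
  have hU : IsUnit W := by
    rw [Matrix.isUnit_iff_isUnit_det, hdet, isUnit_iff_ne_zero]
    simp [e₁, e₂, e₃, e₄]
  have hcc : star c * c = ((‖c‖ ^ 2 : ℝ) : ℂ) := by
    rw [Complex.star_def, ← Complex.normSq_eq_conj_mul_self, Complex.normSq_eq_norm_sq]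
  have hcc' : (starRingEnd ℂ) c * c = ((‖c‖ ^ 2 : ℝ) : ℂ) := hcc
  have ka : (a : ℂ) = x₁ ^ 2 := by rw [← ha]; push_cast; rfl
  have ka' : (1 : ℂ) - a = x₂ ^ 2 := by exact_mod_cast congrArg ((↑) : ℝ → ℂ) ha'.symm
  have kf : (f : ℂ) = (starRingEnd ℂ) c * c / x₁ ^ 2 + x₃ ^ 2 := by
    rw [hcc', ← hf, ← ha]; push_cast; rfl
  have kf' : (1 : ℂ) - f = (starRingEnd ℂ) c * c / x₂ ^ 2 + x₄ ^ 2 := by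
    rw [hcc']
    rw [← ha'] at hf'
    exact_mod_cast congrArg ((↑) : ℝ → ℂ) hf'.symm
  suffices h : choiMat a f ((x₁ * x₂ : ℝ) * b + 0) c ((x₁ * x₄ : ℝ) * d + (-(x₁ * c / x₂) * b))
      ((x₂ * x₃ : ℝ) * e + (x₂ * c / x₁ * star b))
      ((x₃ * x₄ : ℝ) * g + (-(star c * c / (x₁ * x₂)) * b + star c * x₄ / x₁ * d
        - c * x₃ / x₂ * star e)) = W * unitChoiMat b d e g * star W by
    rw [h, hU.posSemidef_star_right_conjugate_iff]
  unfold choiMat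
  rw [ka', kf', ka, kf]
  ext i j
  fin_cases i <;> fin_cases j <;>
    simp [hW, unitChoiMat, Matrix.mul_apply, Fin.sum_univ_succ, Matrix.star_apply] <;>
    field_simp <;> ring

lemma isClosed_posSemidef {n : Type*} [Fintype n] :
    IsClosed {A : Matrix n n ℂ | A.PosSemidef} := by
  simp_rw [posSemidef_iff_dotProduct_mulVec, Set.ofPred_and, Set.ofPred_forall]
  refine IsClosed.inter (isClosed_eq (by fun_prop) (by fun_prop))
    (isClosed_iInter fun x => isClosed_le continuous_const ?_)
  simp only [dotProduct, mulVec]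
  fun_prop

lemma Matrix.PosSemidef.norm_sq_apply_le {n : Type*} {A : Matrix n n ℂ} (hA : A.PosSemidef)
    (i j : n) : ‖A i j‖ ^ 2 ≤ (A i i).re * (A j j).re := by
  have h := (hA.submatrix ![i, j]).det_nonneg
  have hij : A j i = star (A i j) := (hA.1.apply j i).symm
  have hi : ((A i i).re : ℂ) = A i i := hA.1.coe_re_apply_self i
  have hj : ((A j j).re : ℂ) = A j j := hA.1.coe_re_apply_self j
  rw [Matrix.det_fin_two] at h
  simp only [submatrix_apply, cons_val_zero, cons_val_one, hij, Complex.star_def,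
    Complex.mul_conj] at h
  rw [← hi, ← hj, Complex.normSq_eq_norm_sq] at h
  have := (Complex.le_def.1 h).1
  rw [← Complex.ofReal_mul, ← Complex.ofReal_sub, Complex.ofReal_re, Complex.zero_re] at this
  linarith

lemma unitChoiMat_isHermitian (b d e g : ℂ) : (unitChoiMat b d e g).IsHermitian := by
  ext i j
  fin_cases i <;> fin_cases j <;> simp [unitChoiMat, Matrix.conjTranspose_apply]

lemma unitChoiMat_posSemidef {b d e g : ℂ} (hb : ‖b‖ ≤ 1 / 2) (hd : ‖d‖ ≤ 1 / 2)
    (he : ‖e‖ ≤ 1 / 2) (hg : ‖g‖ ≤ 1 / 2) : (unitChoiMat b d e g).PosSemidef := by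
  have hH := unitChoiMat_isHermitian b d e g
  rw [hH.posSemidef_iff_eigenvalues_nonneg]
  intro i
  have hev : Module.End.HasEigenvalue (Matrix.toLin' (unitChoiMat b d e g))
      ((hH.eigenvalues i : ℝ) : ℂ) := by
    rw [Module.End.hasEigenvalue_iff_mem_spectrum, Matrix.spectrum_toLin']
    exact hH.eigenvalues_mem_spectrum_real i |> fun h => by
      simpa using (spectrum.algebraMap_mem ℂ h)
  obtain ⟨k, hk⟩ := eigenvalue_mem_ball hev
  rw [mem_closedBall_iff_norm] at hk
  have h1 : unitChoiMat b d e g k k = 1 := by fin_cases k <;> rfl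
  have h2 : ∑ j ∈ Finset.univ.erase k, ‖unitChoiMat b d e g k j‖ ≤ 1 := by
    rw [Finset.sum_erase_eq_sub (Finset.mem_univ k), h1]
    fin_cases k <;> simp [unitChoiMat, Fin.sum_univ_succ] <;> linarith
  rw [h1, ← Complex.ofReal_one, ← Complex.ofReal_sub, Complex.norm_real, Real.norm_eq_abs] at hk
  have := abs_le.1 (hk.trans h2)
  simp only [Pi.zero_apply]
  linarith [this.1]

lemma continuous_unitChoiMat :
    Continuous fun q : ℂ × ℂ × ℂ × ℂ => unitChoiMat q.1 q.2.1 q.2.2.1 q.2.2.2 := by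
  refine continuous_matrix fun i j => ?_
  fin_cases i <;> fin_cases j <;> simp [unitChoiMat] <;> fun_prop

/-- The set of Choi matrices with unit diagonal and vanishing entry `c`. -/
def unitChoiSet : Set (ℂ × ℂ × ℂ × ℂ) :=
  {q | (unitChoiMat q.1 q.2.1 q.2.2.1 q.2.2.2).PosSemidef}

lemma isClosed_unitChoiSet : IsClosed unitChoiSet :=
  isClosed_posSemidef.preimage continuous_unitChoiMat

lemma volume_unitChoiSet_ne_zero : volume unitChoiSet ≠ 0 := by
  have h : Metric.ball (0 : ℂ × ℂ × ℂ × ℂ) (1 / 2) ⊆ unitChoiSet := by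
    intro q hq
    rw [mem_ball_zero_iff] at hq
    simp only [Prod.norm_def, sup_lt_iff] at hq
    exact unitChoiMat_posSemidef hq.1.le hq.2.1.le hq.2.2.1.le hq.2.2.2.le
  have h2 : (volume : Measure (ℂ × ℂ)).IsOpenPosMeasure :=
    inferInstanceAs (Measure.prod volume volume).IsOpenPosMeasure
  have h3 : (volume : Measure (ℂ × ℂ × ℂ)).IsOpenPosMeasure :=
    inferInstanceAs (Measure.prod volume volume).IsOpenPosMeasure
  have h4 : (volume : Measure (ℂ × ℂ × ℂ × ℂ)).IsOpenPosMeasure :=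
    inferInstanceAs (Measure.prod volume volume).IsOpenPosMeasure
  exact ((Metric.measure_ball_pos volume _ (by norm_num)).trans_le (measure_mono h)).ne'

lemma volume_unitChoiSet_ne_top : volume unitChoiSet ≠ ∞ := by
  have h : unitChoiSet ⊆ Metric.closedBall (0 : ℂ × ℂ × ℂ × ℂ) 1 := by
    intro q hq
    have hq' : ∀ i j, ‖unitChoiMat q.1 q.2.1 q.2.2.1 q.2.2.2 i j‖ ^ 2 ≤ 1 := fun i j => by
      refine (Matrix.PosSemidef.norm_sq_apply_le hq i j).trans_eq ?_
      fin_cases i <;> fin_cases j <;> simp [unitChoiMat]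
    have h01 := hq' 0 1
    have h03 := hq' 0 3
    have h12 := hq' 1 2
    have h23 := hq' 2 3
    simp [unitChoiMat] at h01 h03 h12 h23
    simp only [mem_closedBall_zero_iff, Prod.norm_def, sup_le_iff]
    exact ⟨h01, h03, h12, h23⟩
  exact ((measure_mono h).trans_lt (isCompact_closedBall _ _).measure_lt_top).ne

lemma volume_prod_complex_four {S : Set (ℂ × ℂ × ℂ × ℂ)} (hS : MeasurableSet S) :
    volume S = ∫⁻ b, ∫⁻ d, ∫⁻ e, ∫⁻ g, S.indicator (fun _ => (1 : ℝ≥0∞)) (b, d, e, g) := by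
  rw [Measure.volume_eq_prod, Measure.prod_apply hS]
  refine lintegral_congr fun b => ?_
  have h1 := hS.preimage (measurable_prodMk_left (x := b))
  rw [Measure.volume_eq_prod, Measure.prod_apply h1]
  refine lintegral_congr fun d => ?_
  have h2 := h1.preimage (measurable_prodMk_left (x := d))
  rw [Measure.volume_eq_prod, Measure.prod_apply h2]
  refine lintegral_congr fun e => ?_
  have h3 := h2.preimage (measurable_prodMk_left (x := e))
  rw [← lintegral_indicator_one h3]
  rfl

lemma volume_prod_complex_five {S : Set (ℂ × ℂ × ℂ × ℂ × ℂ)} (hS : MeasurableSet S) :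
    volume S = ∫⁻ c, volume {q : ℂ × ℂ × ℂ × ℂ | (q.1, c, q.2) ∈ S} := by
  have hm : Measurable fun r : (ℂ × ℂ) × (ℂ × ℂ × ℂ) => (r.1.1, r.1.2, r.2) := by fun_prop
  have hm' : Measurable fun p : ℂ × ℂ => volume {x : ℂ × ℂ × ℂ | (p.1, p.2, x) ∈ S} :=
    measurable_measure_prodMk_left (hS.preimage hm)
  have e1 : volume S = ∫⁻ b, ∫⁻ c, volume {x : ℂ × ℂ × ℂ | (b, c, x) ∈ S} := by
    rw [Measure.volume_eq_prod, Measure.prod_apply hS]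
    refine lintegral_congr fun b => ?_
    have h1 := hS.preimage (measurable_prodMk_left (x := b))
    rw [Measure.volume_eq_prod, Measure.prod_apply h1]
    rfl
  rw [e1, lintegral_lintegral_swap hm'.aemeasurable]
  refine lintegral_congr fun c => ?_
  have h2 : MeasurableSet {q : ℂ × ℂ × ℂ × ℂ | (q.1, c, q.2) ∈ S} :=
    hS.preimage (f := fun q : ℂ × ℂ × ℂ × ℂ => (q.1, c, q.2)) (by fun_prop)
  exact (Measure.prod_apply h2).symm

/-- The set of qubit channels with prescribed diagonal parameters `a` and `f`. -/
def choiFiber (a f : ℝ) : Set (ℂ × ℂ × ℂ × ℂ × ℂ) :=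
  {q | (choiMat a f q.1 q.2.1 q.2.2.1 q.2.2.2.1 q.2.2.2.2).PosSemidef}

lemma continuous_choiMat : Continuous fun p : ℝ × ℝ × ℂ × ℂ × ℂ × ℂ × ℂ =>
    choiMat p.1 p.2.1 p.2.2.1 p.2.2.2.1 p.2.2.2.2.1 p.2.2.2.2.2.1 p.2.2.2.2.2.2 := by
  refine continuous_matrix fun i j => ?_
  fin_cases i <;> fin_cases j <;> simp [choiMat] <;> fun_prop

lemma isClosed_qubitChannelSet : IsClosed qubitChannelSet :=
  (isClosed_Icc.preimage continuous_fst).inter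
    ((isClosed_Icc.preimage (continuous_fst.comp continuous_snd)).inter
      (isClosed_posSemidef.preimage continuous_choiMat))

lemma isClosed_choiFiber (a f : ℝ) : IsClosed (choiFiber a f) :=
  isClosed_posSemidef.preimage (continuous_choiMat.comp
    (by fun_prop : Continuous fun q : ℂ × ℂ × ℂ × ℂ × ℂ => (a, f, q)))

lemma volume_choiFiber_slice {a f : ℝ} (ha : a ∈ Set.Ioo (0 : ℝ) 1) {c : ℂ}
    (h₁ : ‖c‖ ^ 2 < a * f) (h₂ : ‖c‖ ^ 2 < (1 - a) * (1 - f)) :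
    volume {q : ℂ × ℂ × ℂ × ℂ | (q.1, c, q.2) ∈ choiFiber a f}
      = ENNReal.ofReal ((a * f - ‖c‖ ^ 2) ^ 2 * ((1 - a) * (1 - f) - ‖c‖ ^ 2) ^ 2)
        * volume unitChoiSet := by
  have a0 : 0 < a := ha.1
  have a1 : 0 < 1 - a := by linarith [ha.2]
  have hm3 : 0 < f - ‖c‖ ^ 2 / a := by
    rw [sub_pos, div_lt_iff₀ a0]; linarith
  have hm4 : 0 < 1 - f - ‖c‖ ^ 2 / (1 - a) := by
    rw [sub_pos, div_lt_iff₀ a1]; linarith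
  obtain ⟨x₁, p₁, s₁⟩ : ∃ x : ℝ, 0 < x ∧ x ^ 2 = a := ⟨√a, by positivity, Real.sq_sqrt a0.le⟩
  obtain ⟨x₂, p₂, s₂⟩ : ∃ x : ℝ, 0 < x ∧ x ^ 2 = 1 - a :=
    ⟨√(1 - a), by positivity, Real.sq_sqrt a1.le⟩
  obtain ⟨x₃, p₃, s₃⟩ : ∃ x : ℝ, 0 < x ∧ x ^ 2 = f - ‖c‖ ^ 2 / a :=
    ⟨√(f - ‖c‖ ^ 2 / a), Real.sqrt_pos.2 hm3, Real.sq_sqrt hm3.le⟩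
  obtain ⟨x₄, p₄, s₄⟩ : ∃ x : ℝ, 0 < x ∧ x ^ 2 = 1 - f - ‖c‖ ^ 2 / (1 - a) :=
    ⟨√(1 - f - ‖c‖ ^ 2 / (1 - a)), Real.sqrt_pos.2 hm4, Real.sq_sqrt hm4.le⟩
  have hS : MeasurableSet {q : ℂ × ℂ × ℂ × ℂ | (q.1, c, q.2) ∈ choiFiber a f} :=
    (isClosed_choiFiber a f).measurableSet.preimage
      (f := fun q : ℂ × ℂ × ℂ × ℂ => (q.1, c, q.2)) (by fun_prop)
  rw [volume_prod_complex_four hS, volume_prod_complex_four isClosed_unitChoiSet.measurableSet]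
  set S := {q : ℂ × ℂ × ℂ × ℂ | (q.1, c, q.2) ∈ choiFiber a f} with hSdef
  have key : ∀ b d e g, S.indicator (fun _ => (1 : ℝ≥0∞))
      ((x₁ * x₂ : ℝ) * b + 0, (x₁ * x₄ : ℝ) * d + (-(x₁ * c / x₂) * b),
        (x₂ * x₃ : ℝ) * e + (x₂ * c / x₁ * star b),
        (x₃ * x₄ : ℝ) * g + (-(star c * c / (x₁ * x₂)) * b + star c * x₄ / x₁ * d
          - c * x₃ / x₂ * star e))
      = unitChoiSet.indicator (fun _ => (1 : ℝ≥0∞)) (b, d, e, g) := fun b d e g =>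
    Set.indicator_eq_indicator (choiMat_posSemidef_iff p₁ p₂ p₃ p₄ s₁ s₂ (by linarith)
      (by linarith) b d e g) rfl
  have hg : ∀ b d e, ∫⁻ g, S.indicator (fun _ => (1 : ℝ≥0∞))
      ((x₁ * x₂ : ℝ) * b + 0, (x₁ * x₄ : ℝ) * d + (-(x₁ * c / x₂) * b),
        (x₂ * x₃ : ℝ) * e + (x₂ * c / x₁ * star b), g)
      = ENNReal.ofReal ((x₃ * x₄) ^ 2)
        * ∫⁻ g, unitChoiSet.indicator (fun _ => (1 : ℝ≥0∞)) (b, d, e, g) := fun b d e => by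
    rw [lintegral_complex_eq_mul _ (mul_pos p₃ p₄) (-(star c * c / (x₁ * x₂)) * b
      + star c * x₄ / x₁ * d - c * x₃ / x₂ * star e)]
    simp_rw [key]
  have he : ∀ b d, ∫⁻ e, ∫⁻ g, S.indicator (fun _ => (1 : ℝ≥0∞))
      ((x₁ * x₂ : ℝ) * b + 0, (x₁ * x₄ : ℝ) * d + (-(x₁ * c / x₂) * b), e, g)
      = ENNReal.ofReal ((x₂ * x₃) ^ 2) * (ENNReal.ofReal ((x₃ * x₄) ^ 2)
        * ∫⁻ e, ∫⁻ g, unitChoiSet.indicator (fun _ => (1 : ℝ≥0∞)) (b, d, e, g)) := fun b d => by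
    rw [lintegral_complex_eq_mul _ (mul_pos p₂ p₃) (x₂ * c / x₁ * star b)]
    simp_rw [hg]
    rw [lintegral_const_mul' _ _ ENNReal.ofReal_ne_top]
  have hd : ∀ b, ∫⁻ d, ∫⁻ e, ∫⁻ g, S.indicator (fun _ => (1 : ℝ≥0∞))
      ((x₁ * x₂ : ℝ) * b + 0, d, e, g)
      = ENNReal.ofReal ((x₁ * x₄) ^ 2) * (ENNReal.ofReal ((x₂ * x₃) ^ 2)
        * (ENNReal.ofReal ((x₃ * x₄) ^ 2) * ∫⁻ d, ∫⁻ e, ∫⁻ g,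
          unitChoiSet.indicator (fun _ => (1 : ℝ≥0∞)) (b, d, e, g))) := fun b => by
    rw [lintegral_complex_eq_mul _ (mul_pos p₁ p₄) (-(x₁ * c / x₂) * b)]
    simp_rw [he]
    rw [lintegral_const_mul' _ _ ENNReal.ofReal_ne_top,
      lintegral_const_mul' _ _ ENNReal.ofReal_ne_top]
  rw [lintegral_complex_eq_mul _ (mul_pos p₁ p₂) 0]
  simp_rw [hd]
  rw [lintegral_const_mul' _ _ ENNReal.ofReal_ne_top,
    lintegral_const_mul' _ _ ENNReal.ofReal_ne_top,
    lintegral_const_mul' _ _ ENNReal.ofReal_ne_top, ← mul_assoc, ← mul_assoc, ← mul_assoc,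
    ← ENNReal.ofReal_mul (by positivity), ← ENNReal.ofReal_mul (by positivity),
    ← ENNReal.ofReal_mul (by positivity)]
  congr 2
  have e1 : a * f - ‖c‖ ^ 2 = x₁ ^ 2 * x₃ ^ 2 := by rw [s₁, s₃]; field_simp
  have e2 : (1 - a) * (1 - f) - ‖c‖ ^ 2 = x₂ ^ 2 * x₄ ^ 2 := by rw [s₂, s₄]; field_simp
  rw [e1, e2]
  ring

lemma norm_sq_le_of_mem_choiFiber {a f : ℝ} {q : ℂ × ℂ × ℂ × ℂ × ℂ} (hq : q ∈ choiFiber a f) :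
    ‖q.2.1‖ ^ 2 ≤ a * f ∧ ‖q.2.1‖ ^ 2 ≤ (1 - a) * (1 - f) := by
  have h02 := Matrix.PosSemidef.norm_sq_apply_le hq 0 2
  have h13 := Matrix.PosSemidef.norm_sq_apply_le hq 1 3
  simp [choiMat] at h02 h13
  exact ⟨h02, h13⟩

lemma lintegral_complex_norm {h : ℝ → ℝ≥0∞} (hh : Measurable h) :
    ∫⁻ c : ℂ, h ‖c‖
      = ENNReal.ofReal (2 * π) * ∫⁻ r in Set.Ioi (0 : ℝ), ENNReal.ofReal r * h r := by
  rw [← Complex.lintegral_comp_polarCoord_symm, polarCoord_target, Measure.volume_eq_prod,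
    setLIntegral_prod _ (by simp_rw [Complex.norm_polarCoord_symm]; fun_prop)]
  simp_rw [Complex.norm_polarCoord_symm, setLIntegral_const, Real.volume_Ioo]
  rw [← lintegral_const_mul _ (by fun_prop)]
  refine setLIntegral_congr_fun measurableSet_Ioi fun r hr => ?_
  simp only [abs_of_pos (Set.mem_Ioi.1 hr), smul_eq_mul]
  rw [mul_comm, sub_neg_eq_add, two_mul]

/-- Fundamental theorem of calculus for a lower Lebesgue integral over a bounded interval. -/
lemma setLIntegral_Ioo_ofReal_of_hasDerivAt {φ Φ : ℝ → ℝ} {a b : ℝ} (hab : a ≤ b)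
    (hΦ : ∀ x, HasDerivAt Φ (φ x) x) (hc : Continuous φ) (hpos : ∀ x ∈ Set.Ioo a b, 0 ≤ φ x) :
    ∫⁻ x in Set.Ioo a b, ENNReal.ofReal (φ x) = ENNReal.ofReal (Φ b - Φ a) := by
  have hi : IntegrableOn φ (Set.Ioo a b) :=
    (hc.integrableOn_Icc (a := a) (b := b)).mono_set Set.Ioo_subset_Icc_self
  rw [← ofReal_integral_eq_lintegral_ofReal hi
    (ae_restrict_of_forall_mem measurableSet_Ioo hpos), ← integral_Ioc_eq_integral_Ioo,
    ← intervalIntegral.integral_of_le hab,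
    intervalIntegral.integral_eq_sub_of_hasDerivAt (fun x _ => hΦ x) (hc.intervalIntegrable _ _)]

/-- The primitive vanishing at `0` of `u ↦ u ^ 2 * (u + s) ^ 2`. -/
noncomputable def choiPrimitive (m s : ℝ) : ℝ := m ^ 5 / 5 + s * m ^ 4 / 2 + s ^ 2 * m ^ 3 / 3

lemma hasDerivAt_choiPrimitive (m s : ℝ) :
    HasDerivAt (fun u => choiPrimitive u s) (m ^ 2 * (m + s) ^ 2) m := by
  unfold choiPrimitive
  have h := (((hasDerivAt_pow 5 m).div_const 5).add
    (((hasDerivAt_pow 4 m).const_mul s).div_const 2)).add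
    (((hasDerivAt_pow 3 m).const_mul (s ^ 2)).div_const 3)
  refine h.congr_deriv ?_
  norm_num
  ring

/-- Up to a constant, the volume of `choiFiber a f`. -/
noncomputable def choiWeight (a f : ℝ) : ℝ :=
  choiPrimitive (min (a * f) ((1 - a) * (1 - f))) |a + f - 1|

lemma choiWeight_eq_of_add_le {a f : ℝ} (h : a + f ≤ 1) :
    choiWeight a f = choiPrimitive (a * f) (1 - a - f) := by
  rw [choiWeight, min_eq_left (by nlinarith), abs_of_nonpos (by linarith)]
  congr 1; ring

lemma choiWeight_one_sub (a f : ℝ) : choiWeight (1 - a) (1 - f) = choiWeight a f := by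
  rw [choiWeight, choiWeight, min_comm, ← abs_neg]
  congr 2 <;> ring

lemma setLIntegral_choiSlice {a f : ℝ} (ha : a ∈ Set.Ioo (0 : ℝ) 1) (hf : f ∈ Set.Ioo (0 : ℝ) 1) :
    ∫⁻ r in Set.Ioi (0 : ℝ), ENNReal.ofReal r *
      (if r ^ 2 < min (a * f) ((1 - a) * (1 - f)) then
        ENNReal.ofReal ((a * f - r ^ 2) ^ 2 * ((1 - a) * (1 - f) - r ^ 2) ^ 2) else 0)
      = ENNReal.ofReal (choiWeight a f / 2) := by
  obtain ⟨a0, a1⟩ := ha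
  obtain ⟨f0, f1⟩ := hf
  set m := min (a * f) ((1 - a) * (1 - f)) with hm
  have m0 : 0 < m := lt_min (mul_pos a0 f0) (mul_pos (by linarith) (by linarith))
  set s := |a + f - 1| with hs
  have hprod : ∀ t : ℝ, (a * f - t) ^ 2 * ((1 - a) * (1 - f) - t) ^ 2
      = (m - t) ^ 2 * ((m - t) + s) ^ 2 := by
    intro t
    rcases le_total (a + f) 1 with h | h
    · rw [hm, hs, min_eq_left (by nlinarith), abs_of_nonpos (by linarith)]; ring
    · rw [hm, hs, min_eq_right (by nlinarith), abs_of_nonneg (by linarith)]; ring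
  have h1 : ∀ r ∈ Set.Ioi (0 : ℝ), (ENNReal.ofReal r *
      (if r ^ 2 < m then
        ENNReal.ofReal ((a * f - r ^ 2) ^ 2 * ((1 - a) * (1 - f) - r ^ 2) ^ 2) else 0))
      = (Set.Ioo 0 (√m)).indicator
        (fun r => ENNReal.ofReal (r * ((m - r ^ 2) ^ 2 * ((m - r ^ 2) + s) ^ 2))) r := by
    intro r hr
    have hr : 0 < r := hr
    simp only [Set.indicator_apply, Set.mem_Ioo, Real.lt_sqrt hr.le, hr, true_and, hprod]
    split_ifs
    · rw [ENNReal.ofReal_mul hr.le]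
    · rw [mul_zero]
  rw [setLIntegral_congr_fun measurableSet_Ioi h1, setLIntegral_indicator measurableSet_Ioo,
    Set.inter_eq_left.2 Set.Ioo_subset_Ioi_self,
    setLIntegral_Ioo_ofReal_of_hasDerivAt (Φ := fun r => -(choiPrimitive (m - r ^ 2) s / 2))
      (Real.sqrt_nonneg m) ?_ (by fun_prop) ?_]
  · simp only [Real.sq_sqrt m0.le, sub_self]
    congr 1
    rw [choiWeight]
    simp [choiPrimitive, m, s]
  · intro r
    have h := (((hasDerivAt_choiPrimitive (m - r ^ 2) s).comp r
      ((hasDerivAt_pow 2 r).const_sub m)).div_const 2).neg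
    refine h.congr_deriv ?_
    norm_num
    ring
  · intro r hr
    have := hr.1
    positivity

lemma volume_choiFiber {a f : ℝ} (ha : a ∈ Set.Ioo (0 : ℝ) 1) (hf : f ∈ Set.Ioo (0 : ℝ) 1) :
    volume (choiFiber a f)
      = ENNReal.ofReal π * volume unitChoiSet * ENNReal.ofReal (choiWeight a f) := by
  set m := min (a * f) ((1 - a) * (1 - f)) with hm
  set h : ℝ → ℝ≥0∞ := fun r => if r ^ 2 < m then
    ENNReal.ofReal ((a * f - r ^ 2) ^ 2 * ((1 - a) * (1 - f) - r ^ 2) ^ 2) else 0 with hh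
  have hmeas : Measurable h :=
    Measurable.ite (measurableSet_lt (by fun_prop) measurable_const) (by fun_prop) measurable_const
  have hae : ∀ᵐ c : ℂ, volume {q : ℂ × ℂ × ℂ × ℂ | (q.1, c, q.2) ∈ choiFiber a f}
      = h ‖c‖ * volume unitChoiSet := by
    have hnull : ∀ᵐ c : ℂ, c ∉ Metric.sphere (0 : ℂ) (√m) :=
      measure_eq_zero_iff_ae_notMem.1 (Measure.addHaar_sphere volume 0 (√m))
    filter_upwards [hnull] with c hc
    rcases lt_trichotomy (‖c‖ ^ 2) m with hlt | heq | hgt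
    · simp only [hh, hlt, if_true]
      exact volume_choiFiber_slice ha (lt_min_iff.1 hlt).1 (lt_min_iff.1 hlt).2
    · exact absurd (by rw [mem_sphere_zero_iff_norm, ← heq, Real.sqrt_sq (norm_nonneg c)]) hc
    · simp only [hh, hgt.not_gt, if_false, zero_mul]
      rw [measure_eq_zero_iff_ae_notMem]
      refine Filter.Eventually.of_forall fun q hq => ?_
      exact hgt.not_ge (le_min_iff.2 (norm_sq_le_of_mem_choiFiber hq))
  rw [volume_prod_complex_five (isClosed_choiFiber a f).measurableSet, lintegral_congr_ae hae,
    lintegral_mul_const' _ _ volume_unitChoiSet_ne_top, lintegral_complex_norm hmeas,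
    setLIntegral_choiSlice ha hf, ← ENNReal.ofReal_mul (by positivity),
    mul_right_comm (ENNReal.ofReal π), ← ENNReal.ofReal_mul pi_pos.le]
  congr 2
  ring

lemma choiPrimitive_nonneg {m s : ℝ} (hm : 0 ≤ m) (hs : 0 ≤ s) : 0 ≤ choiPrimitive m s := by
  unfold choiPrimitive; positivity

lemma setLIntegral_unit_ofReal_sum {n : ℕ} {φ : ℝ → ℝ} (c : Fin n → ℝ)
    (hφ : ∀ t, φ t = ∑ i, c i * t ^ (i : ℕ)) (hpos : ∀ t ∈ Set.Ioo (0 : ℝ) 1, 0 ≤ φ t) :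
    ∫⁻ t in Set.Ioo (0 : ℝ) 1, ENNReal.ofReal (φ t)
      = ENNReal.ofReal (∑ i, c i / ((i : ℕ) + 1)) := by
  have hc : Continuous φ := by
    rw [funext hφ]; fun_prop
  rw [setLIntegral_Ioo_ofReal_of_hasDerivAt
    (Φ := fun t => ∑ i, c i * t ^ ((i : ℕ) + 1) / ((i : ℕ) + 1)) zero_le_one ?_ hc hpos]
  · simp
  · intro t
    rw [hφ]
    refine HasDerivAt.fun_sum fun i _ => ?_
    refine (((hasDerivAt_pow ((i : ℕ) + 1) t).const_mul (c i)).div_const _).congr_deriv ?_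
    have : ((i : ℕ) : ℝ) + 1 ≠ 0 := by positivity
    push_cast
    field_simp

/-- The value of `∫ t in 0..1, choiPrimitive (t * (A - B * t)) (s₀ + s₁ * t)`. -/
noncomputable def choiMoment (A B s₀ s₁ : ℝ) : ℝ :=
  (A ^ 5 / 6 - 5 * A ^ 4 * B / 7 + 10 * A ^ 3 * B ^ 2 / 8 - 10 * A ^ 2 * B ^ 3 / 9
      + 5 * A * B ^ 4 / 10 - B ^ 5 / 11) / 5
    + s₀ * (A ^ 4 / 5 - 4 * A ^ 3 * B / 6 + 6 * A ^ 2 * B ^ 2 / 7 - 4 * A * B ^ 3 / 8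
      + B ^ 4 / 9) / 2
    + s₁ * (A ^ 4 / 6 - 4 * A ^ 3 * B / 7 + 6 * A ^ 2 * B ^ 2 / 8 - 4 * A * B ^ 3 / 9
      + B ^ 4 / 10) / 2
    + s₀ ^ 2 * (A ^ 3 / 4 - 3 * A ^ 2 * B / 5 + 3 * A * B ^ 2 / 6 - B ^ 3 / 7) / 3
    + 2 * s₀ * s₁ * (A ^ 3 / 5 - 3 * A ^ 2 * B / 6 + 3 * A * B ^ 2 / 7 - B ^ 3 / 8) / 3
    + s₁ ^ 2 * (A ^ 3 / 6 - 3 * A ^ 2 * B / 7 + 3 * A * B ^ 2 / 8 - B ^ 3 / 9) / 3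

lemma setLIntegral_choiPrimitive (A B s₀ s₁ : ℝ)
    (hm : ∀ t ∈ Set.Ioo (0 : ℝ) 1, 0 ≤ t * (A - B * t))
    (hs : ∀ t ∈ Set.Ioo (0 : ℝ) 1, 0 ≤ s₀ + s₁ * t) :
    ∫⁻ t in Set.Ioo (0 : ℝ) 1, ENNReal.ofReal (choiPrimitive (t * (A - B * t)) (s₀ + s₁ * t))
      = ENNReal.ofReal (choiMoment A B s₀ s₁) := by
  rw [setLIntegral_unit_ofReal_sum ![0, 0, 0, s₀ ^ 2 * A ^ 3 / 3,
    s₀ * A ^ 4 / 2 - s₀ ^ 2 * (3 * A ^ 2 * B) / 3 + 2 * s₀ * s₁ * A ^ 3 / 3,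
    A ^ 5 / 5 - s₀ * (4 * A ^ 3 * B) / 2 + s₁ * A ^ 4 / 2 + s₀ ^ 2 * (3 * A * B ^ 2) / 3
      - 2 * s₀ * s₁ * (3 * A ^ 2 * B) / 3 + s₁ ^ 2 * A ^ 3 / 3,
    -(5 * A ^ 4 * B / 5) + s₀ * (6 * A ^ 2 * B ^ 2) / 2 - s₁ * (4 * A ^ 3 * B) / 2
      - s₀ ^ 2 * B ^ 3 / 3 + 2 * s₀ * s₁ * (3 * A * B ^ 2) / 3 - s₁ ^ 2 * (3 * A ^ 2 * B) / 3,
    10 * A ^ 3 * B ^ 2 / 5 - s₀ * (4 * A * B ^ 3) / 2 + s₁ * (6 * A ^ 2 * B ^ 2) / 2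
      - 2 * s₀ * s₁ * B ^ 3 / 3 + s₁ ^ 2 * (3 * A * B ^ 2) / 3,
    -(10 * A ^ 2 * B ^ 3 / 5) + s₀ * B ^ 4 / 2 - s₁ * (4 * A * B ^ 3) / 2 - s₁ ^ 2 * B ^ 3 / 3,
    5 * A * B ^ 4 / 5 + s₁ * B ^ 4 / 2, -(B ^ 5 / 5)] ?_
    fun t ht => choiPrimitive_nonneg (hm t ht) (hs t ht)]
  · congr 1
    simp [Fin.sum_univ_succ, choiMoment]
    ring
  · intro t
    simp [Fin.sum_univ_succ, choiPrimitive]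
    ring

lemma setLIntegral_Ioo_eq_mul (F : ℝ → ℝ≥0∞) {α β : ℝ} (h : α < β) :
    ∫⁻ a in Set.Ioo α β, F a
      = ENNReal.ofReal (β - α) * ∫⁻ t in Set.Ioo (0 : ℝ) 1, F (α + (β - α) * t) := by
  have h' : 0 < β - α := sub_pos.2 h
  rw [← lintegral_indicator measurableSet_Ioo, ← lintegral_indicator measurableSet_Ioo,
    lintegral_real_eq_mul _ h' α]
  congr 2 with t
  refine Set.indicator_eq_indicator ?_ (by rw [add_comm])
  simp only [Set.mem_Ioo]
  constructor <;> rintro ⟨h1, h2⟩ <;> constructor <;> nlinarith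

lemma setLIntegral_Ioo_eq_mul' (F : ℝ → ℝ≥0∞) {α β : ℝ} (h : α < β) :
    ∫⁻ a in Set.Ioo α β, F a
      = ENNReal.ofReal (β - α) * ∫⁻ t in Set.Ioo (0 : ℝ) 1, F (β - (β - α) * t) := by
  rw [setLIntegral_Ioo_eq_mul F h]
  congr 1
  rw [← lintegral_indicator measurableSet_Ioo, ← lintegral_indicator measurableSet_Ioo,
    ← lintegral_sub_left_eq_self _ (1 : ℝ)]
  refine lintegral_congr fun t => Set.indicator_eq_indicator ?_ (by congr 1; ring)
  simp only [Set.mem_Ioo]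
  constructor <;> rintro ⟨h1, h2⟩ <;> constructor <;> linarith

/-- The unnormalized density of the diagonal parameters `(a, f)`. -/
noncomputable def choiDensity (a f : ℝ) : ℝ≥0∞ :=
  if a ∈ Set.Ioo (0 : ℝ) 1 ∧ f ∈ Set.Ioo (0 : ℝ) 1 then ENNReal.ofReal (choiWeight a f) else 0

lemma measurable_choiDensity : Measurable fun p : ℝ × ℝ => choiDensity p.1 p.2 := by
  unfold choiDensity choiWeight choiPrimitive
  refine Measurable.ite ?_ (by fun_prop) measurable_const
  exact (measurableSet_Ioo.preimage measurable_fst).inter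
    (measurableSet_Ioo.preimage measurable_snd)

lemma choiDensity_one_sub (a f : ℝ) : choiDensity (1 - a) (1 - f) = choiDensity a f := by
  simp only [choiDensity, choiWeight_one_sub, Set.mem_Ioo, sub_pos, sub_lt_self_iff,
    and_comm (a := _ < (1 : ℝ))]

/-- The unnormalized density of the `z`-component. -/
noncomputable def zDensity (r ξ : ℝ) : ℝ≥0∞ :=
  ENNReal.ofReal (1 - r)⁻¹ * ∫⁻ a, choiDensity a ((1 - r)⁻¹ * ξ + (1 - (1 + r) * a) * (1 - r)⁻¹)

/-- The part of `choiDensity` below the diagonal `a + f = 1`. -/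
noncomputable def choiDensityLow (a f : ℝ) : ℝ≥0∞ :=
  if 0 < a ∧ 0 < f ∧ a + f < 1 then ENNReal.ofReal (choiPrimitive (a * f) (1 - a - f)) else 0

lemma measurable_choiDensityLow : Measurable fun p : ℝ × ℝ => choiDensityLow p.1 p.2 := by
  unfold choiDensityLow choiPrimitive
  refine Measurable.ite ?_ (by fun_prop) measurable_const
  exact (measurableSet_lt measurable_const measurable_fst).inter
    ((measurableSet_lt measurable_const measurable_snd).inter
      (measurableSet_lt (measurable_fst.add measurable_snd) measurable_const))

lemma Measurable.choiDensityLow {u v : ℝ → ℝ} (hu : Measurable u) (hv : Measurable v) :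
    Measurable fun x => choiDensityLow (u x) (v x) :=
  measurable_choiDensityLow.comp (hu.prodMk hv)

lemma choiDensity_eq_add {a f : ℝ} (h : a + f ≠ 1) :
    choiDensity a f = choiDensityLow a f + choiDensityLow (1 - a) (1 - f) := by
  have hlow : ∀ {a f : ℝ}, a + f < 1 →
      choiDensity a f = choiDensityLow a f ∧ choiDensityLow (1 - a) (1 - f) = 0 := by
    intro a f h
    constructor
    · rw [choiDensity, choiDensityLow, choiWeight_eq_of_add_le h.le]
      refine if_congr ⟨fun h' => ⟨h'.1.1, h'.2.1, h⟩, fun h' => ?_⟩ rfl rfl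
      obtain ⟨h1, h2, h3⟩ := h'
      exact ⟨⟨h1, by linarith⟩, ⟨h2, by linarith⟩⟩
    · rw [choiDensityLow, if_neg]
      rintro ⟨-, -, h3⟩
      linarith
  rcases lt_or_gt_of_ne h with h | h
  · rw [(hlow h).1, (hlow h).2, add_zero]
  · have h' := hlow (a := 1 - a) (f := 1 - f) (by linarith)
    rw [sub_sub_cancel, sub_sub_cancel] at h'
    rw [← choiDensity_one_sub, h'.1, h'.2, zero_add]

lemma lintegral_choiDensityLow_right {a : ℝ} (ha : a ∈ Set.Ioo (0 : ℝ) 1) :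
    ∫⁻ f, choiDensityLow a f = ENNReal.ofReal (a ^ 5 * (1 - a) ^ 6 / 30
      + a ^ 4 * (1 - a) ^ 6 / 60 + a ^ 3 * (1 - a) ^ 6 / 180) := by
  obtain ⟨a0, a1⟩ := ha
  have hind : (fun f => choiDensityLow a f) = (Set.Ioo 0 (1 - a)).indicator
      (fun f => ENNReal.ofReal (choiPrimitive (a * f) (1 - a - f))) := by
    ext f
    simp only [choiDensityLow, Set.indicator_apply, Set.mem_Ioo, a0, true_and, lt_sub_iff_add_lt']
  have hsub : ∀ t : ℝ, choiPrimitive (a * (0 + (1 - a - 0) * t)) (1 - a - (0 + (1 - a - 0) * t))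
      = choiPrimitive (t * (a * (1 - a) - 0 * t)) (1 - a + -(1 - a) * t) := fun t => by
    congr 1 <;> ring
  rw [hind, lintegral_indicator measurableSet_Ioo, setLIntegral_Ioo_eq_mul _ (by linarith)]
  simp_rw [hsub]
  rw [setLIntegral_choiPrimitive, ← ENNReal.ofReal_mul (by linarith)]
  · congr 1
    unfold choiMoment
    ring
  · intro t ht
    have := ht.1
    have : 0 < 1 - a := by linarith
    rw [zero_mul, sub_zero]
    positivity
  · intro t ht
    nlinarith [ht.2]

lemma lintegral_lintegral_choiDensityLow :
    ∫⁻ a, ∫⁻ f, choiDensityLow a f = ENNReal.ofReal (1 / 50400) := by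
  have h : ∀ᵐ a : ℝ, ∫⁻ f, choiDensityLow a f = (Set.Ioo (0 : ℝ) 1).indicator
      (fun a => ENNReal.ofReal (a ^ 5 * (1 - a) ^ 6 / 30
        + a ^ 4 * (1 - a) ^ 6 / 60 + a ^ 3 * (1 - a) ^ 6 / 180)) a := by
    refine Filter.Eventually.of_forall fun a => ?_
    rw [Set.indicator_apply]
    split_ifs with ha
    · exact lintegral_choiDensityLow_right ha
    · refine (lintegral_congr fun f => if_neg ?_).trans lintegral_zero
      rintro ⟨h1, h2, h3⟩
      exact ha ⟨h1, by linarith⟩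
  rw [lintegral_congr_ae h, lintegral_indicator measurableSet_Ioo,
    setLIntegral_unit_ofReal_sum ![0, 0, 0, 1 / 180, 1 / 60 - 6 / 180, 1 / 30 - 6 / 60 + 15 / 180,
      -6 / 30 + 15 / 60 - 20 / 180, 15 / 30 - 20 / 60 + 15 / 180, -20 / 30 + 15 / 60 - 6 / 180,
      15 / 30 - 6 / 60 + 1 / 180, -6 / 30 + 1 / 60, 1 / 30]]
  · congr 1
    simp [Fin.sum_univ_succ]
    norm_num
  · intro t
    simp [Fin.sum_univ_succ]
    ring
  · intro t ht
    have := ht.1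
    have : 0 < 1 - t := by linarith [ht.2]
    positivity

lemma lintegral_lintegral_choiDensity :
    ∫⁻ a, ∫⁻ f, choiDensity a f = ENNReal.ofReal (1 / 25200) := by
  have h : ∀ a, ∫⁻ f, choiDensity a f
      = (∫⁻ f, choiDensityLow a f) + ∫⁻ f, choiDensityLow (1 - a) f := by
    intro a
    have hae : ∀ᵐ f : ℝ, choiDensity a f = choiDensityLow a f + choiDensityLow (1 - a) (1 - f) := by
      filter_upwards [Measure.ae_ne volume (1 - a)] with f hf
      exact choiDensity_eq_add fun h => hf (by linarith)
    rw [lintegral_congr_ae hae, lintegral_add_left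
      (measurable_const.choiDensityLow measurable_id'),
      lintegral_sub_left_eq_self (fun f => choiDensityLow (1 - a) f) (1 : ℝ)]
  simp_rw [h]
  have hm : Measurable fun a => ∫⁻ f, choiDensityLow a f :=
    measurable_choiDensityLow.lintegral_prod_right'
  rw [lintegral_add_left hm,
    lintegral_sub_left_eq_self (fun a => ∫⁻ f, choiDensityLow a f) (1 : ℝ),
    lintegral_lintegral_choiDensityLow, ← ENNReal.ofReal_add (by norm_num) (by norm_num)]
  norm_num

/-- The contribution of the region `a + f < 1` to `zDensity`. -/
noncomputable def zDensityLow (r ξ : ℝ) : ℝ≥0∞ :=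
  ∫⁻ a, choiDensityLow a ((1 - r)⁻¹ * ξ + (1 - (1 + r) * a) * (1 - r)⁻¹)

lemma zDensity_eq_add {r : ℝ} (hr : r ∈ Set.Ioo (0 : ℝ) 1) (ξ : ℝ) :
    zDensity r ξ = ENNReal.ofReal (1 - r)⁻¹ * (zDensityLow r ξ + zDensityLow r (-ξ)) := by
  have r1 : 1 - r ≠ 0 := by linarith [hr.2]
  have r0 := hr.1
  rw [zDensity, zDensityLow, zDensityLow]
  congr 1
  have hae : ∀ᵐ a : ℝ, choiDensity a ((1 - r)⁻¹ * ξ + (1 - (1 + r) * a) * (1 - r)⁻¹)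
      = choiDensityLow a ((1 - r)⁻¹ * ξ + (1 - (1 + r) * a) * (1 - r)⁻¹)
        + choiDensityLow (1 - a) ((1 - r)⁻¹ * -ξ + (1 - (1 + r) * (1 - a)) * (1 - r)⁻¹) := by
    filter_upwards [Measure.ae_ne volume ((ξ + r) / (2 * r))] with a ha
    rw [choiDensity_eq_add]
    · congr 2
      field_simp
      ring
    · contrapose! ha
      field_simp at ha ⊢
      linarith
  rw [lintegral_congr_ae hae, lintegral_add_left
      (measurable_id'.choiDensityLow (by fun_prop)),
    lintegral_sub_left_eq_self
      (fun a => choiDensityLow a ((1 - r)⁻¹ * -ξ + (1 - (1 + r) * a) * (1 - r)⁻¹)) (1 : ℝ)]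

lemma choiDensityLow_line {r : ℝ} (hr : r ∈ Set.Ioo (0 : ℝ) 1) (ξ a : ℝ) :
    choiDensityLow a ((1 - r)⁻¹ * ξ + (1 - (1 + r) * a) * (1 - r)⁻¹) =
      (Set.Ioo (max 0 ((ξ + r) / (2 * r))) ((1 + ξ) / (1 + r))).indicator
        (fun a => ENNReal.ofReal (choiPrimitive (a * ((1 + ξ - (1 + r) * a) / (1 - r)))
          ((2 * r * a - (ξ + r)) / (1 - r)))) a := by
  have r0 := hr.1
  have r1 : 0 < 1 - r := by linarith [hr.2]
  have e : (1 - r)⁻¹ * ξ + (1 - (1 + r) * a) * (1 - r)⁻¹ = (1 + ξ - (1 + r) * a) / (1 - r) := by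
    field_simp; ring
  have e2 : 1 - a - (1 + ξ - (1 + r) * a) / (1 - r) = (2 * r * a - (ξ + r)) / (1 - r) := by
    field_simp; ring
  rw [e, choiDensityLow, Set.indicator_apply, e2]
  refine if_congr ?_ rfl rfl
  have h3 : a + (1 + ξ - (1 + r) * a) / (1 - r) < 1 ↔ (ξ + r) / (2 * r) < a := by
    rw [← sub_pos, ← sub_sub, e2, div_pos_iff_of_pos_right r1, div_lt_iff₀ (by positivity)]
    constructor <;> intro h <;> linarith
  rw [h3, div_pos_iff_of_pos_right r1, sub_pos, Set.mem_Ioo, max_lt_iff,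
    lt_div_iff₀ (by positivity), mul_comm a]
  tauto

lemma zDensityLow_eq_zero {r ξ : ℝ} (hr : r ∈ Set.Ioo (0 : ℝ) 1) (h : r ≤ ξ ∨ ξ ≤ -1) :
    zDensityLow r ξ = 0 := by
  have r0 := hr.1
  have r1 := hr.2
  simp_rw [zDensityLow, choiDensityLow_line hr]
  rw [Set.Ioo_eq_empty, Set.indicator_empty, lintegral_zero]
  rw [not_lt]
  rcases h with h | h
  · refine le_max_of_le_right ?_
    rw [div_le_div_iff₀ (by positivity) (by positivity)]
    nlinarith
  · refine le_max_of_le_left (div_nonpos_of_nonpos_of_nonneg (by linarith) (by linarith))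

lemma zDensityLow_of_lt {r ξ : ℝ} (hr : r ∈ Set.Ioo (0 : ℝ) 1) (h₁ : -1 < ξ) (h₂ : ξ < -r) :
    zDensityLow r ξ = ENNReal.ofReal ((1 + ξ) / (1 + r)
      * choiMoment ((1 + ξ) ^ 2 / (1 - r ^ 2)) ((1 + ξ) ^ 2 / (1 - r ^ 2))
        (-(ξ + r) / (1 - r)) (2 * r * (1 + ξ) / (1 - r ^ 2))) := by
  have r0 := hr.1
  have r1 : 0 < 1 - r := by linarith [hr.2]
  have e : 1 - r ^ 2 = (1 - r) * (1 + r) := by ring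
  have hx : 0 < 1 + ξ := by linarith
  have hx2 : 0 < -(ξ + r) := by linarith
  have hb : 0 < (1 + ξ) / (1 + r) := by positivity
  have hmax : max 0 ((ξ + r) / (2 * r)) = 0 :=
    max_eq_left (div_nonpos_of_nonpos_of_nonneg (by linarith) (by linarith))
  simp_rw [zDensityLow, choiDensityLow_line hr, hmax]
  rw [lintegral_indicator measurableSet_Ioo, setLIntegral_Ioo_eq_mul _ hb, sub_zero]
  have hsub : ∀ t : ℝ,
      choiPrimitive ((0 + (1 + ξ) / (1 + r) * t)
          * ((1 + ξ - (1 + r) * (0 + (1 + ξ) / (1 + r) * t)) / (1 - r)))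
        ((2 * r * (0 + (1 + ξ) / (1 + r) * t) - (ξ + r)) / (1 - r))
      = choiPrimitive (t * ((1 + ξ) ^ 2 / (1 - r ^ 2) - (1 + ξ) ^ 2 / (1 - r ^ 2) * t))
        (-(ξ + r) / (1 - r) + 2 * r * (1 + ξ) / (1 - r ^ 2) * t) := fun t => by
    rw [e]
    congr 1 <;> field_simp <;> ring
  simp_rw [hsub]
  rw [setLIntegral_choiPrimitive, ← ENNReal.ofReal_mul hb.le]
  · rintro t ⟨t0, t1⟩
    have : 0 < 1 - t := by linarith
    rw [e, ← mul_one_sub]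
    positivity
  · rintro t ⟨t0, t1⟩
    rw [e]
    positivity

lemma zDensityLow_of_abs_lt {r ξ : ℝ} (hr : r ∈ Set.Ioo (0 : ℝ) 1) (h : |ξ| < r) :
    zDensityLow r ξ = ENNReal.ofReal ((1 - r) * (r - ξ) / (2 * r * (1 + r))
      * choiMoment ((r - ξ) / (2 * r) * ((1 + ξ) / (1 + r)))
        ((r - ξ) / (2 * r) * ((1 - r) * (r - ξ) / (2 * r * (1 + r))))
        ((r - ξ) / (1 + r)) (-((r - ξ) / (1 + r)))) := by
  have r0 := hr.1
  have r1 : 0 < 1 - r := by linarith [hr.2]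
  obtain ⟨h₁, h₂⟩ := abs_lt.1 h
  have hx : 0 < 1 + ξ := by linarith
  have hx2 : 0 < r - ξ := by linarith
  have hx3 : 0 < ξ + r := by linarith
  have hd : (1 + ξ) / (1 + r) - (ξ + r) / (2 * r) = (1 - r) * (r - ξ) / (2 * r * (1 + r)) := by
    field_simp; ring
  have hdpos : 0 < (1 - r) * (r - ξ) / (2 * r * (1 + r)) := by positivity
  have hmax : max 0 ((ξ + r) / (2 * r)) = (ξ + r) / (2 * r) := max_eq_right (by positivity)
  simp_rw [zDensityLow, choiDensityLow_line hr, hmax]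
  rw [lintegral_indicator measurableSet_Ioo, setLIntegral_Ioo_eq_mul' _ (by linarith), hd]
  have hsub : ∀ t : ℝ,
      choiPrimitive (((1 + ξ) / (1 + r) - (1 - r) * (r - ξ) / (2 * r * (1 + r)) * t)
          * ((1 + ξ - (1 + r) * ((1 + ξ) / (1 + r) - (1 - r) * (r - ξ) / (2 * r * (1 + r)) * t))
            / (1 - r)))
        ((2 * r * ((1 + ξ) / (1 + r) - (1 - r) * (r - ξ) / (2 * r * (1 + r)) * t) - (ξ + r))
          / (1 - r))
      = choiPrimitive (t * ((r - ξ) / (2 * r) * ((1 + ξ) / (1 + r))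
          - (r - ξ) / (2 * r) * ((1 - r) * (r - ξ) / (2 * r * (1 + r))) * t))
        ((r - ξ) / (1 + r) + -((r - ξ) / (1 + r)) * t) := fun t => by
    congr 1 <;> field_simp <;> ring
  simp_rw [hsub]
  rw [setLIntegral_choiPrimitive, ← ENNReal.ofReal_mul hdpos.le]
  · rintro t ⟨t0, t1⟩
    rw [mul_assoc, ← mul_sub]
    have : (1 - r) * (r - ξ) / (2 * r * (1 + r)) * t
        < (1 - r) * (r - ξ) / (2 * r * (1 + r)) := mul_lt_of_lt_one_right hdpos t1
    have : 0 < (ξ + r) / (2 * r) := by positivity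
    refine mul_nonneg t0.le (mul_nonneg (by positivity) (by linarith))
  · rintro t ⟨t0, t1⟩
    have : 0 < (r - ξ) / (1 + r) := by positivity
    nlinarith

lemma volume_qubitChannelSet_inter (r : ℝ) {E : Set ℝ} (hE : MeasurableSet E) :
    volume ((fun p : ℝ × ℝ × ℂ × ℂ × ℂ × ℂ × ℂ => p.1 + p.2.1 - 1 + r * (p.1 - p.2.1)) ⁻¹' E
        ∩ qubitChannelSet)
      = ENNReal.ofReal π * volume unitChoiSet
        * ∫⁻ a, ∫⁻ f, E.indicator 1 (a + f - 1 + r * (a - f)) * choiDensity a f := by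
  have hK : ENNReal.ofReal π * volume unitChoiSet ≠ ∞ :=
    ENNReal.mul_ne_top ENNReal.ofReal_ne_top volume_unitChoiSet_ne_top
  have hT : MeasurableSet ((fun p : ℝ × ℝ × ℂ × ℂ × ℂ × ℂ × ℂ =>
      p.1 + p.2.1 - 1 + r * (p.1 - p.2.1)) ⁻¹' E ∩ qubitChannelSet) :=
    (hE.preimage (by fun_prop)).inter isClosed_qubitChannelSet.measurableSet
  rw [Measure.volume_eq_prod, Measure.prod_apply hT, ← lintegral_const_mul' _ _ hK]
  refine lintegral_congr_ae ?_
  filter_upwards [Measure.ae_ne volume 0, Measure.ae_ne volume 1] with a ha0 ha1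
  have hT' := hT.preimage (measurable_prodMk_left (x := a))
  rw [Measure.volume_eq_prod, Measure.prod_apply hT', ← lintegral_const_mul' _ _ hK]
  refine lintegral_congr_ae ?_
  filter_upwards [Measure.ae_ne volume 0, Measure.ae_ne volume 1] with f hf0 hf1
  have hIcc : ∀ {x : ℝ}, x ≠ 0 → x ≠ 1 → (x ∈ Set.Icc (0 : ℝ) 1 ↔ x ∈ Set.Ioo (0 : ℝ) 1) :=
    fun h0 h1 => ⟨fun h => ⟨h.1.lt_of_ne' h0, h.2.lt_of_ne h1⟩, fun h => Set.Ioo_subset_Icc_self h⟩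
  by_cases h : (a + f - 1 + r * (a - f) ∈ E) ∧ a ∈ Set.Ioo (0 : ℝ) 1 ∧ f ∈ Set.Ioo (0 : ℝ) 1
  · have hset : Prod.mk f ⁻¹' (Prod.mk a ⁻¹' ((fun p : ℝ × ℝ × ℂ × ℂ × ℂ × ℂ × ℂ =>
        p.1 + p.2.1 - 1 + r * (p.1 - p.2.1)) ⁻¹' E ∩ qubitChannelSet)) = choiFiber a f := by
      ext q
      exact ⟨fun hq => hq.2.2.2, fun hq =>
        ⟨h.1, (hIcc ha0 ha1).2 h.2.1, (hIcc hf0 hf1).2 h.2.2, hq⟩⟩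
    rw [hset, volume_choiFiber h.2.1 h.2.2, choiDensity, if_pos h.2, Set.indicator_of_mem h.1,
      Pi.one_apply, one_mul]
  · have hset : Prod.mk f ⁻¹' (Prod.mk a ⁻¹' ((fun p : ℝ × ℝ × ℂ × ℂ × ℂ × ℂ × ℂ =>
        p.1 + p.2.1 - 1 + r * (p.1 - p.2.1)) ⁻¹' E ∩ qubitChannelSet)) = ∅ := by
      ext q
      simp only [Set.mem_empty_iff_false, iff_false]
      exact fun hq => h ⟨hq.1, (hIcc ha0 ha1).1 hq.2.1, (hIcc hf0 hf1).1 hq.2.2.1⟩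
    rw [hset, measure_empty]
    rw [not_and_or] at h
    rcases h with h | h
    · rw [Set.indicator_of_notMem h, zero_mul, mul_zero]
    · rw [choiDensity, if_neg h, mul_zero, mul_zero]

lemma volume_qubitChannelSet :
    volume qubitChannelSet
      = ENNReal.ofReal π * volume unitChoiSet * ENNReal.ofReal (1 / 25200) := by
  have h := volume_qubitChannelSet_inter 0 MeasurableSet.univ
  simpa [lintegral_lintegral_choiDensity] using h

lemma lintegral_indicator_mul_choiDensity {r : ℝ} (hr : r ∈ Set.Ioo (0 : ℝ) 1) {E : Set ℝ}
    (hE : MeasurableSet E) :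
    ∫⁻ a, ∫⁻ f, E.indicator 1 (a + f - 1 + r * (a - f)) * choiDensity a f
      = ∫⁻ ξ in E, zDensity r ξ := by
  have r1 : 0 < 1 - r := by linarith [hr.2]
  have hsub : ∀ a, ∫⁻ f, E.indicator 1 (a + f - 1 + r * (a - f)) * choiDensity a f
      = ENNReal.ofReal (1 - r)⁻¹ * ∫⁻ ξ, E.indicator 1 ξ
        * choiDensity a ((1 - r)⁻¹ * ξ + (1 - (1 + r) * a) * (1 - r)⁻¹) := fun a => by
    rw [lintegral_real_eq_mul _ (inv_pos.2 r1) ((1 - (1 + r) * a) * (1 - r)⁻¹)]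
    congr 2 with ξ
    congr 2
    field_simp
    ring
  have hm : Measurable fun p : ℝ × ℝ => E.indicator (1 : ℝ → ℝ≥0∞) p.2
      * choiDensity p.1 ((1 - r)⁻¹ * p.2 + (1 - (1 + r) * p.1) * (1 - r)⁻¹) :=
    ((measurable_one.indicator hE).comp measurable_snd).mul
      (measurable_choiDensity.comp (by fun_prop : Measurable fun p : ℝ × ℝ =>
        (p.1, (1 - r)⁻¹ * p.2 + (1 - (1 + r) * p.1) * (1 - r)⁻¹)))
  simp_rw [hsub]
  rw [lintegral_const_mul' _ _ ENNReal.ofReal_ne_top, lintegral_lintegral_swap hm.aemeasurable,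
    ← lintegral_const_mul' _ _ ENNReal.ofReal_ne_top, ← lintegral_indicator hE]
  refine lintegral_congr fun ξ => ?_
  by_cases h : ξ ∈ E
  · simp [h, zDensity]
  · simp [h]

lemma choiMoment_nonneg {A B s : ℝ} (hB : 0 ≤ B) (hA : B ≤ A) (hs : 0 ≤ s) :
    0 ≤ choiMoment A B s (-s) := by
  obtain ⟨C, hC, rfl⟩ := exists_nonneg_add_of_le hA
  unfold choiMoment
  ring_nf
  positivity

lemma choiMoment_abs_lt_nonneg {r ξ : ℝ} (hr : r ∈ Set.Ioo (0 : ℝ) 1) (h : |ξ| < r) :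
    0 ≤ (1 - r) * (r - ξ) / (2 * r * (1 + r))
      * choiMoment ((r - ξ) / (2 * r) * ((1 + ξ) / (1 + r)))
        ((r - ξ) / (2 * r) * ((1 - r) * (r - ξ) / (2 * r * (1 + r))))
        ((r - ξ) / (1 + r)) (-((r - ξ) / (1 + r))) := by
  have r0 := hr.1
  have r1 : 0 < 1 - r := by linarith [hr.2]
  obtain ⟨h₁, h₂⟩ := abs_lt.1 h
  have hx2 : 0 < r - ξ := by linarith
  have hx3 : 0 < ξ + r := by linarith
  refine mul_nonneg (by positivity) (choiMoment_nonneg (by positivity) ?_ (by positivity))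
  gcongr ?_ * ?_
  have hd : (1 + ξ) / (1 + r) - (1 - r) * (r - ξ) / (2 * r * (1 + r)) = (ξ + r) / (2 * r) := by
    field_simp; ring
  rw [← sub_nonneg, hd]
  positivity

lemma zDensity_of_abs_lt {r ξ : ℝ} (hr : r ∈ Set.Ioo (0 : ℝ) 1) (h : |ξ| < r) :
    zDensity r ξ = ENNReal.ofReal (1 / 25200) *
      ENNReal.ofReal ((-10 / (33 * r * (1 + r) ^ 6))
        * (231 * ξ ^ 6 - 99 * ξ ^ 4 * r ^ 2 + 33 * ξ ^ 2 * r ^ 4 - 5 * r ^ 6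
          - 594 * ξ ^ 4 * r + 198 * ξ ^ 2 * r ^ 3 - 30 * r ^ 5
          + 396 * ξ ^ 2 * r ^ 2 - 72 * r ^ 4 + 66 * ξ ^ 2 * r
          - 82 * r ^ 3 - 36 * r ^ 2 - 6 * r)) := by
  have r0 := hr.1
  have r1 : 0 < 1 - r := by linarith [hr.2]
  rw [zDensity_eq_add hr, zDensityLow_of_abs_lt hr h, zDensityLow_of_abs_lt hr (by rwa [abs_neg]),
    ← ENNReal.ofReal_add (choiMoment_abs_lt_nonneg hr h)
      (choiMoment_abs_lt_nonneg hr (by rwa [abs_neg])),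
    ← ENNReal.ofReal_mul (inv_nonneg.2 r1.le), ← ENNReal.ofReal_mul (by norm_num)]
  congr 1
  unfold choiMoment
  field_simp
  ring

lemma zDensity_of_lt {r ξ : ℝ} (hr : r ∈ Set.Ioo (0 : ℝ) 1) (h₁ : r < ξ) (h₂ : ξ < 1) :
    zDensity r ξ = ENNReal.ofReal (1 / 25200) *
      ENNReal.ofReal ((20 * (1 - ξ) ^ 7 / (33 * (1 - r ^ 2) ^ 6))
        * (3 * ξ ^ 4 - 22 * ξ ^ 2 * r ^ 2 + 99 * r ^ 4 + 21 * ξ ^ 3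
          - 154 * ξ * r ^ 2 + 51 * ξ ^ 2 - 22 * r ^ 2 + 21 * ξ + 3)) := by
  have r0 := hr.1
  have r1 : 0 < 1 - r := by linarith [hr.2]
  have e : 1 - r ^ 2 = (1 - r) * (1 + r) := by ring
  rw [zDensity_eq_add hr, zDensityLow_eq_zero hr (Or.inl h₁.le),
    zDensityLow_of_lt hr (by linarith) (by linarith), zero_add,
    ← ENNReal.ofReal_mul (inv_nonneg.2 r1.le), ← ENNReal.ofReal_mul (by norm_num)]
  congr 1
  rw [e, choiMoment]
  field_simp
  ring

lemma zDensity_neg {r : ℝ} (hr : r ∈ Set.Ioo (0 : ℝ) 1) (ξ : ℝ) :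
    zDensity r (-ξ) = zDensity r ξ := by
  rw [zDensity_eq_add hr, zDensity_eq_add hr, neg_neg, add_comm]

lemma zDensity_eq_zero {r ξ : ℝ} (hr : r ∈ Set.Ioo (0 : ℝ) 1) (h : 1 ≤ |ξ|) :
    zDensity r ξ = 0 := by
  have hr1 := hr.2
  rw [zDensity_eq_add hr]
  rcases le_abs.1 h with h | h
  · rw [zDensityLow_eq_zero hr (Or.inl (by linarith)),
      zDensityLow_eq_zero hr (Or.inr (by linarith)), add_zero, mul_zero]
  · rw [zDensityLow_eq_zero hr (Or.inr (by linarith)),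
      zDensityLow_eq_zero hr (Or.inl (by linarith)), add_zero, mul_zero]

/-- For `r₀ ∈ (0,1)`, the `z`-component `a + f − 1 + r₀(a − f)` of the image of the state
with Bloch vector `(0,0,r₀)` under a uniformly random qubit channel has the displayed
piecewise Lebesgue density. -/
theorem z_density_general (r₀ : ℝ) (hr₀ : r₀ ∈ Set.Ioo (0 : ℝ) 1) :
    Measure.map
        (fun p : ℝ × ℝ × ℂ × ℂ × ℂ × ℂ × ℂ =>
          p.1 + p.2.1 - 1 + r₀ * (p.1 - p.2.1))
        uniformQubitChannel
      = volume.withDensity (fun ξ : ℝ =>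
          if |ξ| ≤ r₀ then
            ENNReal.ofReal ((-10 / (33 * r₀ * (1 + r₀) ^ 6))
              * (231 * ξ ^ 6 - 99 * ξ ^ 4 * r₀ ^ 2 + 33 * ξ ^ 2 * r₀ ^ 4 - 5 * r₀ ^ 6
                - 594 * ξ ^ 4 * r₀ + 198 * ξ ^ 2 * r₀ ^ 3 - 30 * r₀ ^ 5
                + 396 * ξ ^ 2 * r₀ ^ 2 - 72 * r₀ ^ 4 + 66 * ξ ^ 2 * r₀
                - 82 * r₀ ^ 3 - 36 * r₀ ^ 2 - 6 * r₀))
          else if |ξ| ≤ 1 then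
            ENNReal.ofReal ((20 * (1 - |ξ|) ^ 7 / (33 * (1 - r₀ ^ 2) ^ 6))
              * (3 * ξ ^ 4 - 22 * ξ ^ 2 * r₀ ^ 2 + 99 * r₀ ^ 4 + 21 * |ξ| ^ 3
                - 154 * |ξ| * r₀ ^ 2 + 51 * ξ ^ 2 - 22 * r₀ ^ 2 + 21 * |ξ| + 3))
          else 0) := by
  ext E hE
  set ρ : ℝ → ℝ≥0∞ := fun ξ => _
  have hae : ∀ᵐ ξ : ℝ, zDensity r₀ ξ = ENNReal.ofReal (1 / 25200) * ρ ξ := by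
    filter_upwards [Measure.ae_ne volume r₀, Measure.ae_ne volume (-r₀), Measure.ae_ne volume 1,
      Measure.ae_ne volume (-1)] with ξ h1 h2 h3 h4
    have hr : |ξ| ≠ r₀ := fun h => (abs_eq hr₀.1.le).1 h |>.elim h1 h2
    have hone : |ξ| ≠ 1 := fun h => (abs_eq zero_le_one).1 h |>.elim h3 h4
    simp only [ρ]
    split_ifs with h h'
    · exact zDensity_of_abs_lt hr₀ (h.lt_of_ne hr)
    · rw [← sq_abs ξ, ← Even.pow_abs (by decide : Even 4) ξ,
        ← zDensity_of_lt hr₀ (not_le.1 h) (h'.lt_of_ne hone)]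
      rcases abs_choice ξ with h | h <;> rw [h]
      rw [zDensity_neg hr₀]
    · rw [mul_zero, zDensity_eq_zero hr₀ (not_le.1 h').le]
  have hK0 : ENNReal.ofReal π * volume unitChoiSet ≠ 0 :=
    mul_ne_zero (by simpa using pi_pos) volume_unitChoiSet_ne_zero
  have hK : ENNReal.ofReal π * volume unitChoiSet ≠ ∞ :=
    ENNReal.mul_ne_top ENNReal.ofReal_ne_top volume_unitChoiSet_ne_top
  have hN0 : ENNReal.ofReal (1 / 25200) ≠ 0 := by simp
  rw [uniformQubitChannel, Measure.map_apply (by fun_prop) hE, Measure.smul_apply, smul_eq_mul,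
    Measure.restrict_apply (hE.preimage (by fun_prop)), volume_qubitChannelSet_inter r₀ hE,
    lintegral_indicator_mul_choiDensity hr₀ hE, volume_qubitChannelSet,
    withDensity_apply _ hE, lintegral_congr_ae (ae_restrict_of_ae hae),
    lintegral_const_mul' _ _ ENNReal.ofReal_ne_top, ← mul_assoc, ← mul_assoc, mul_assoc _⁻¹,
    ENNReal.inv_mul_cancel (mul_ne_zero hK0 hN0) (ENNReal.mul_ne_top hK ENNReal.ofReal_ne_top),
    one_mul]
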